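/- arXiv:1709.04728 — 2 statements merged into one kernel-verified Lean document; each statement's English description precedes it below -/
import Mathlib

section
/- Let X be an n×d real matrix with columns x^(1),…,x^(d), and let h(x₁,…,x_d) = x₁+⋯+x_d be the sum operator. If f(x₁,…,x_d) = g(x₁+⋯+x_d) for a convex function g:ℝ→ℝ, then the minimum of Σ_{k=1}^n f(x̃^(1)_k,…,x̃^(d)_k) over all matrices X̃ obtained from X by permuting entries within columns is attained at some matrix X̃ such that, for every i ∈ {1,…,d}, the i-th column x̃^(i) is oppositely ordered to the vector of row sums of the remaining columns. -/
/-- Decreasing rearrangement of a vector. -/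
noncomputable def decSort {n : ℕ} (x : Fin n → ℝ) : Fin n → ℝ :=
  fun i => x (Tuple.sort x i.rev)

/-- Increasing rearrangement of a vector. -/
noncomputable def incSort {n : ℕ} (x : Fin n → ℝ) : Fin n → ℝ :=
  fun i => x (Tuple.sort x i)

/-- Sum of the `k` largest components. -/
noncomputable def topSum {n : ℕ} (k : ℕ) (x : Fin n → ℝ) : ℝ :=
  ∑ i ∈ Finset.univ.filter (fun i : Fin n => (i : ℕ) < k), decSort x i

/-- Sum of the `k` smallest components. -/
noncomputable def botSum {n : ℕ} (k : ℕ) (x : Fin n → ℝ) : ℝ :=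
  ∑ i ∈ Finset.univ.filter (fun i : Fin n => (i : ℕ) < k), incSort x i

/-- `x ≺ y` : majorization. -/
def Maj {n : ℕ} (x y : Fin n → ℝ) : Prop :=
  (∀ k < n, topSum k x ≤ topSum k y) ∧ (∑ i, x i = ∑ i, y i)

/-- `x ≺_w y` : weak submajorization. -/
def WSubMaj {n : ℕ} (x y : Fin n → ℝ) : Prop :=
  ∀ k ≤ n, topSum k x ≤ topSum k y

/-- `x ≺^w y` : weak supermajorization. -/
def WSupMaj {n : ℕ} (x y : Fin n → ℝ) : Prop :=
  ∀ k ≤ n, botSum k y ≤ botSum k x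

/-- Schur-convexity. -/
def SchurConvex {n : ℕ} (φ : (Fin n → ℝ) → ℝ) : Prop :=
  ∀ x y, Maj x y → φ x ≤ φ y

/-- `Y` is obtained from `X` by permuting the entries within each column. -/
def InPermSet {n d : ℕ} (X Y : Fin n → Fin d → ℝ) : Prop :=
  ∀ i : Fin d, ∃ π : Equiv.Perm (Fin n), ∀ k, Y k i = X (π k) i

/-- `x` and `y` are oppositely ordered. -/
def OppOrd {n : ℕ} (x y : Fin n → ℝ) : Prop :=
  ∀ k l, (x k - x l) * (y k - y l) ≤ 0

/-- Supermodularity for functions of two real variables. -/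
def Supermod2 (h : ℝ → ℝ → ℝ) : Prop :=
  ∀ a a' b b', h a b + h a' b' ≤ h (min a a') (min b b') + h (max a a') (max b b')

/-- Supermodularity for functions on `ℝ^m`. -/
def SupermodPi {m : ℕ} (h : (Fin m → ℝ) → ℝ) : Prop :=
  ∀ x y, h x + h y ≤ h (x ⊓ y) + h (x ⊔ y)

/-- `h` is strictly monotone in each component. -/
def StrictCompMono {m : ℕ} (h : (Fin m → ℝ) → ℝ) : Prop :=
  ∀ i : Fin m,
    (∀ x : Fin m → ℝ, StrictMono fun t => h (Function.update x i t)) ∨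
    (∀ x : Fin m → ℝ, StrictAnti fun t => h (Function.update x i t))

/-- For convex `g`, pairing the larger of two summands with the smaller costs no more than pairing
like with like. -/
lemma ConvexOn.add_swap_le {g : ℝ → ℝ} (hg : ConvexOn ℝ Set.univ g) {a b r s : ℝ}
    (hab : a < b) (hrs : r < s) : g (a + s) + g (b + r) ≤ g (b + s) + g (a + r) := by
  have hpos : 0 < (b - a) + (s - r) := by linarith
  have hne := hpos.ne'
  have ht : 0 ≤ (b - a) / ((b - a) + (s - r)) := div_nonneg (by linarith) hpos.le
  have hu : 0 ≤ (s - r) / ((b - a) + (s - r)) := div_nonneg (by linarith) hpos.le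
  have htu : (b - a) / ((b - a) + (s - r)) + (s - r) / ((b - a) + (s - r)) = 1 := by
    rw [← add_div, div_self hne]
  have hut := (add_comm _ _).trans htu
  have h₁ := hg.2 (Set.mem_univ (b + s)) (Set.mem_univ (a + r)) ht hu htu
  have h₂ := hg.2 (Set.mem_univ (b + s)) (Set.mem_univ (a + r)) hu ht hut
  simp only [smul_eq_mul] at h₁ h₂
  generalize hT : (b - a) / ((b - a) + (s - r)) = t at *
  generalize hU : (s - r) / ((b - a) + (s - r)) = u at *
  have hT' : t * ((b - a) + (s - r)) = b - a := by rw [← hT, div_mul_cancel₀ _ hne]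
  obtain rfl : u = 1 - t := by linarith
  have e₁ : t * (b + s) + (1 - t) * (a + r) = b + r := by linear_combination hT'
  have e₂ : (1 - t) * (b + s) + t * (a + r) = a + s := by linear_combination -hT'
  rw [e₁] at h₁
  rw [e₂] at h₂
  linarith

/-- Effect on `∑ m, G (x m + r m)` of transposing two entries of `x`. -/
lemma sum_add_comp_swap_sub {ι : Type*} [Fintype ι] [DecidableEq ι] (G : ℝ → ℝ) (x r : ι → ℝ)
    {k l : ι} (hkl : k ≠ l) :
    ∑ m, G (x (Equiv.swap k l m) + r m) - ∑ m, G (x m + r m) =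
      (G (x l + r k) - G (x k + r k)) + (G (x k + r l) - G (x l + r l)) := by
  rw [← Finset.sum_sub_distrib, Fintype.sum_eq_add k l hkl]
  · simp
  · rintro m ⟨hk, hl⟩
    simp [Equiv.swap_apply_of_ne_of_ne hk hl]

/-- Transposing two entries of one column stays within the column rearrangements. -/
lemma InPermSet.swap {n d : ℕ} {X Y : Fin n → Fin d → ℝ} (h : InPermSet X Y) (i : Fin d)
    (k l : Fin n) :
    InPermSet X (fun m => Function.update (Y m) i (Y (Equiv.swap k l m) i)) := by
  intro j
  obtain ⟨π, hπ⟩ := h j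
  by_cases hj : j = i
  · subst hj
    exact ⟨(Equiv.swap k l).trans π, fun m => by simp [hπ]⟩
  · exact ⟨π, fun m => by simp [hj, hπ]⟩

/-- The set of column rearrangements of a matrix is finite. -/
lemma finite_setOf_inPermSet {n d : ℕ} (X : Fin n → Fin d → ℝ) : {Y | InPermSet X Y}.Finite := by
  refine (Set.finite_range fun (p : Fin d → Equiv.Perm (Fin n)) k i => X (p i k) i).subset ?_
  intro Y hY
  choose p hp using hY
  exact ⟨p, by ext k i; exact (hp i k).symm⟩

/-- Thm 2.4 of Puccetti–Rüschendorf: for `f = g ∘ sum` with `g` convex,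
the minimum of the rowwise cost over all column rearrangements of `X` is attained at a matrix
each of whose columns is oppositely ordered to the row sums of the remaining columns. -/
theorem stmt0 {n d : ℕ} (X : Fin n → Fin d → ℝ) (g : ℝ → ℝ)
    (hg : ConvexOn ℝ Set.univ g) :
    ∃ Xt : Fin n → Fin d → ℝ, InPermSet X Xt ∧
      (∀ i : Fin d,
        OppOrd (fun k => Xt k i) (fun k => ∑ j ∈ Finset.univ.erase i, Xt k j)) ∧
      (∀ Y : Fin n → Fin d → ℝ, InPermSet X Y →
        ∑ k, g (∑ j, Xt k j) ≤ ∑ k, g (∑ j, Y k j)) := by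
  obtain ⟨Z, hZ, hmin⟩ := Set.exists_min_image {Y | InPermSet X Y}
    (fun Y => toLex (∑ k, g (∑ j, Y k j), ∑ k, (∑ j, Y k j) ^ 2))
    (finite_setOf_inPermSet X) ⟨X, fun i => ⟨1, fun k => rfl⟩⟩
  simp only [Set.mem_ofPred_eq] at hZ hmin
  refine ⟨Z, hZ, fun i => ?_, fun Y hY => ?_⟩
  · set r : Fin n → ℝ := fun k => ∑ j ∈ Finset.univ.erase i, Z k j with hr
    have main : ∀ k l, Z l i < Z k i → r l < r k → False := by
      intro k l hx hy
      have hkl : k ≠ l := by rintro rfl; exact lt_irrefl _ hx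
      have hle := hmin _ (hZ.swap i k l)
      have hsum : ∀ m, ∑ j, Z m j = Z m i + r m := fun m =>
        (Finset.add_sum_erase _ _ (Finset.mem_univ i)).symm
      have hsum' : ∀ m, ∑ j, Function.update (Z m) i (Z (Equiv.swap k l m) i) j =
          Z (Equiv.swap k l m) i + r m := by
        intro m
        rw [← Finset.add_sum_erase _ _ (Finset.mem_univ i), Function.update_self]
        congr 1
        exact Finset.sum_congr rfl fun j hj =>
          Function.update_of_ne (Finset.ne_of_mem_erase hj) _ _
      simp only [hsum, hsum'] at hle
      rw [Prod.Lex.toLex_le_toLex] at hle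
      have hcost := sum_add_comp_swap_sub g (fun m => Z m i) r hkl
      have hsq := sum_add_comp_swap_sub (· ^ 2) (fun m => Z m i) r hkl
      have hconv := hg.add_swap_le hx hy
      simp only at hcost hsq hle
      rcases hle with hlt | ⟨-, hle⟩
      · linarith
      · nlinarith [mul_pos (sub_pos.2 hx) (sub_pos.2 hy)]
    intro k l
    by_contra! hpos
    rcases mul_pos_iff.1 hpos with ⟨hx, hy⟩ | ⟨hx, hy⟩
    · exact main k l (sub_pos.1 hx) (sub_pos.1 hy)
    · exact main l k (sub_neg.1 hx) (sub_neg.1 hy)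
  · exact (Prod.Lex.toLex_le_toLex.1 (hmin Y hY)).elim le_of_lt fun h => h.1.le
end

section
/- For any two vectors x, y ∈ ℝⁿ, the vector x_↓ + y_↑ (the sum of the decreasing rearrangement of x and the increasing rearrangement of y) is majorized by the vector x + y; that is, x_↓ + y_↑ ≺ x + y. -/
theorem max_sub_zero_swap_le {a b c d : ℝ} (t : ℝ) (hab : a ≤ b) (hcd : c ≤ d) :
    max (a + d - t) 0 + max (b + c - t) 0 ≤ max (a + c - t) 0 + max (b + d - t) 0 := by
  rcases max_cases (a + d - t) 0 with h1 | h1 <;> rcases max_cases (b + c - t) 0 with h2 | h2 <;>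
  rcases max_cases (a + c - t) 0 with h3 | h3 <;> rcases max_cases (b + d - t) 0 with h4 | h4 <;>
  linarith

/-- Among all pairings, the opposite ordering minimizes the sum of a supermodular function
of the paired entries. -/
theorem Finset.sum_le_sum_comp_perm_of_supermodular {ι : Type*} [LinearOrder ι] {f g : ι → ℝ}
    {h : ℝ → ℝ → ℝ}
    (hh : ∀ a b c d, a ≤ b → c ≤ d → h a d + h b c ≤ h a c + h b d)
    (hf : Antitone f) (hg : Monotone g) (s : Finset ι) (σ : Equiv.Perm ι)
    (hσ : {x | σ x ≠ x} ⊆ s) :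
    ∑ i ∈ s, h (f i) (g i) ≤ ∑ i ∈ s, h (f i) (g (σ i)) := by
  induction s using Finset.induction_on_max generalizing σ with
  | empty => simp
  | insert a s hmax ih =>
    have has : a ∉ s := fun ha => lt_irrefl a (hmax a ha)
    have hτs : {x | (σ.trans (Equiv.swap a (σ a))) x ≠ x} ⊆ s := by
      intro x hx
      simp only [ne_eq, Set.mem_ofPred_eq, Equiv.swap_comp_apply] at hx
      split_ifs at hx with h₁ h₂
      · obtain rfl | hax := eq_or_ne x a
        · contradiction
        · exact Finset.mem_of_mem_insert_of_ne (hσ fun h ↦ hax <| h.symm.trans h₁) hax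
      · exact (hx <| σ.injective h₂.symm).elim
      · exact Finset.mem_of_mem_insert_of_ne (hσ hx) (ne_of_apply_ne _ h₂)
    specialize ih _ hτs
    simp_rw [Finset.sum_insert has]
    obtain hσa | hσa := eq_or_ne a (σ a)
    · rw [← hσa, Equiv.swap_self, Equiv.trans_refl] at ih
      rw [← hσa]
      linarith
    have hne : σ.symm a ≠ a := fun h => hσa (by rw [Equiv.symm_apply_eq] at h; exact h)
    have h1s : σ.symm a ∈ s := by
      refine Finset.mem_of_mem_insert_of_ne (hσ fun h ↦ hne ?_) hne
      rw [Equiv.apply_symm_apply] at h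
      exact h.symm
    have h2s : σ a ∈ s :=
      Finset.mem_of_mem_insert_of_ne (hσ <| σ.injective.ne hσa.symm) hσa.symm
    have hrest : ∑ x ∈ s.erase (σ.symm a), h (f x) (g ((σ.trans (Equiv.swap a (σ a))) x)) =
        ∑ x ∈ s.erase (σ.symm a), h (f x) (g (σ x)) := by
      refine Finset.sum_congr rfl fun x hx ↦ ?_
      rw [Finset.mem_erase, Ne, Equiv.eq_symm_apply] at hx
      rw [Equiv.trans_apply, Equiv.swap_apply_of_ne_of_ne hx.1 (σ.injective.ne _)]
      rintro rfl
      exact has hx.2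
    rw [← s.sum_erase_add (fun x => h (f x) (g ((σ.trans (Equiv.swap a (σ a))) x))) h1s,
      hrest] at ih
    rw [← s.sum_erase_add (fun x => h (f x) (g (σ x))) h1s]
    simp only [Equiv.trans_apply, Equiv.apply_symm_apply, Equiv.swap_apply_left] at ih ⊢
    have := hh _ _ _ _ (hf (hmax _ h1s).le) (hg (hmax _ h2s).le)
    linarith

theorem antitone_decSort {n : ℕ} (x : Fin n → ℝ) : Antitone (decSort x) :=
  fun _ _ hij => Tuple.monotone_sort x (Fin.rev_le_rev.mpr hij)

theorem sum_comp_decSort {n : ℕ} (x : Fin n → ℝ) (φ : ℝ → ℝ) :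
    ∑ i, φ (decSort x i) = ∑ i, φ (x i) :=
  Equiv.sum_comp (Fin.revPerm.trans (Tuple.sort x)) fun i => φ (x i)

theorem exists_perm_sum_add {n : ℕ} (x y : Fin n → ℝ) :
    ∃ σ : Equiv.Perm (Fin n), ∀ φ : ℝ → ℝ,
      ∑ i, φ (x i + y i) = ∑ i, φ (decSort x i + incSort y (σ i)) := by
  refine ⟨(Fin.revPerm.trans (Tuple.sort x)).trans (Tuple.sort y).symm, fun φ => ?_⟩
  rw [← Equiv.sum_comp (Fin.revPerm.trans (Tuple.sort x))]
  simp [decSort, incSort]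

theorem sum_max_sub_zero_decSort_add_incSort_le {n : ℕ} (x y : Fin n → ℝ) (t : ℝ) :
    ∑ i, max (decSort x i + incSort y i - t) 0 ≤ ∑ i, max (x i + y i - t) 0 := by
  obtain ⟨σ, hσ⟩ := exists_perm_sum_add x y
  rw [hσ fun z => max (z - t) 0]
  exact Finset.sum_le_sum_comp_perm_of_supermodular (h := fun a b => max (a + b - t) 0)
    (fun _ _ _ _ => max_sub_zero_swap_le t) (antitone_decSort x) (Tuple.monotone_sort y)
    Finset.univ σ (by simp)

theorem topSum_eq_add {n : ℕ} (k : ℕ) (x : Fin n → ℝ) (t : ℝ) :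
    topSum k x = ∑ i ∈ Finset.univ.filter (fun i : Fin n => (i : ℕ) < k), (decSort x i - t) +
      ∑ _i ∈ Finset.univ.filter (fun i : Fin n => (i : ℕ) < k), t := by
  rw [← Finset.sum_add_distrib]
  simp [topSum]

theorem topSum_le_sum_max_sub_zero_add {n : ℕ} (k : ℕ) (x : Fin n → ℝ) (t : ℝ) :
    topSum k x ≤ ∑ i, max (x i - t) 0 +
      ∑ _i ∈ Finset.univ.filter (fun i : Fin n => (i : ℕ) < k), t := by
  rw [topSum_eq_add k x t, ← sum_comp_decSort x fun z => max (z - t) 0]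
  gcongr
  exact (Finset.sum_le_sum fun _ _ => le_max_left _ _).trans
    (Finset.sum_le_sum_of_subset_of_nonneg (Finset.filter_subset _ _)
      fun _ _ _ => le_max_right _ _)

theorem topSum_eq_sum_max_sub_zero_add {n : ℕ} (k : Fin n) (x : Fin n → ℝ) :
    topSum k x = ∑ i, max (x i - decSort x k) 0 +
      ∑ _i ∈ Finset.univ.filter (fun i : Fin n => (i : ℕ) < k), decSort x k := by
  rw [topSum_eq_add k x (decSort x k), ← sum_comp_decSort x fun z => max (z - decSort x k) 0,
    Finset.sum_filter]
  congr 1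
  refine Finset.sum_congr rfl fun i _ => ?_
  split_ifs with hi
  · exact (max_eq_left (sub_nonneg.2 (antitone_decSort x (Fin.le_def.2 hi.le)))).symm
  · exact (max_eq_right (sub_nonpos.2
      (antitone_decSort x (Fin.le_def.2 (not_lt.1 hi))))).symm

/-- 6.A.2 in Marshall–Olkin: `x↓ + y↑ ≺ x + y`. -/
theorem stmt8 {n : ℕ} (x y : Fin n → ℝ) :
    Maj (fun i => decSort x i + incSort y i) (fun i => x i + y i) := by
  refine ⟨fun k hk => ?_, ?_⟩
  · refine (topSum_le_sum_max_sub_zero_add k _ (decSort (fun i => x i + y i) ⟨k, hk⟩)).trans ?_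
    rw [topSum_eq_sum_max_sub_zero_add ⟨k, hk⟩ fun i => x i + y i]
    gcongr ?_ + _
    exact sum_max_sub_zero_decSort_add_incSort_le x y _
  · rw [Finset.sum_add_distrib, Finset.sum_add_distrib, sum_comp_decSort x fun z => z]
    exact congrArg _ (Equiv.sum_comp (Tuple.sort y) y)
end
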